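/- Let q = 2^{2n+1} for some integer n ≥ 1, let m be an integer, and let ζ be a primitive N-th root of unity where N = q + √(2q) + 1 or N = q − √(2q) + 1 (note √(2q) = 2^{n+1} is an integer). Let S = {ζ^{mb} + ζ^{mqb} + ζ^{−mb} + ζ^{−mqb} : b ∈ ℤ}. Then the field generated over ℚ by S equals ℚ(ζ^m + ζ^{mq} + ζ^{−m} + ζ^{−mq}), the field generated by the single element corresponding to b = 1. -/

import Mathlib

open CategoryTheory

/-- `z` is a complex root of unity. -/
def IsRootOfUnity (z : ℂ) : Prop := ∃ n : ℕ, 0 < n ∧ z ^ n = 1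

/-- The `n`-th cyclotomic field `ℚ(ζ_n)`, realized as the subfield of `ℂ` generated by
all `n`-th roots of unity. -/
noncomputable def cycField (n : ℕ) : Subfield ℂ := Subfield.closure {z : ℂ | z ^ n = 1}

/-- The conductor of a set `S` of cyclotomic integers: the smallest positive integer `n`
such that `S ⊆ ℚ(ζ_n)`. -/
noncomputable def conductorOf (S : Set ℂ) : ℕ := sInf {n : ℕ | 0 < n ∧ S ⊆ (cycField n : Set ℂ)}

open Polynomial IntermediateField

/-- Adjoining a primitive `d`-th root of unity to the field generated by its `p`-th power
gives an extension of degree at least `p - 1`. -/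
lemma IsPrimitiveRoot.totient_le_natDegree_minpoly_adjoin_pow {L : Type*} [Field L] [CharZero L]
    {ω : L} {d p : ℕ} (hd : 0 < d) (hp : p ∣ d) (hω : IsPrimitiveRoot ω d) :
    p.totient ≤ (minpoly ℚ⟮ω ^ p⟯ ω).natDegree := by
  obtain ⟨e, rfl⟩ := hp
  have he : 0 < e := Nat.pos_of_mul_pos_left hd
  have hint : IsIntegral ℚ ω := hω.isIntegral hd |>.tower_top
  have hintK : IsIntegral ℚ⟮ω ^ p⟯ ω := hint.tower_top
  have hpow : IsPrimitiveRoot (ω ^ p) e := hω.pow hd rfl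
  have hK : Module.finrank ℚ ℚ⟮ω ^ p⟯ = e.totient := by
    rw [adjoin.finrank (hint.pow p), ← cyclotomic_eq_minpoly_rat hpow he, natDegree_cyclotomic]
  have hL : Module.finrank ℚ ℚ⟮ω⟯ = (p * e).totient := by
    rw [adjoin.finrank hint, ← cyclotomic_eq_minpoly_rat hω hd, natDegree_cyclotomic]
  have : FiniteDimensional ℚ ℚ⟮ω ^ p⟯ := adjoin.finiteDimensional (hint.pow p)
  have : FiniteDimensional ℚ⟮ω ^ p⟯ ℚ⟮ω ^ p⟯⟮ω⟯ := adjoin.finiteDimensional hintK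
  have : FiniteDimensional ℚ ℚ⟮ω ^ p⟯⟮ω⟯ := FiniteDimensional.trans ℚ ℚ⟮ω ^ p⟯ _
  have hle : ℚ⟮ω⟯ ≤ (ℚ⟮ω ^ p⟯⟮ω⟯).restrictScalars ℚ := by
    rw [adjoin_simple_le_iff]
    exact mem_adjoin_simple_self _ ω
  have : FiniteDimensional ℚ ((ℚ⟮ω ^ p⟯⟮ω⟯).restrictScalars ℚ) :=
    inferInstanceAs (FiniteDimensional ℚ ℚ⟮ω ^ p⟯⟮ω⟯)
  have h1 : Module.finrank ℚ ℚ⟮ω⟯ ≤ Module.finrank ℚ ((ℚ⟮ω ^ p⟯⟮ω⟯).restrictScalars ℚ) :=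
    Submodule.finrank_mono (s := Subalgebra.toSubmodule ℚ⟮ω⟯.toSubalgebra)
      (t := Subalgebra.toSubmodule ((ℚ⟮ω ^ p⟯⟮ω⟯).restrictScalars ℚ).toSubalgebra) hle
  have h2 : Module.finrank ℚ ((ℚ⟮ω ^ p⟯⟮ω⟯).restrictScalars ℚ) =
      e.totient * (minpoly ℚ⟮ω ^ p⟯ ω).natDegree := by
    rw [← hK, ← adjoin.finrank hintK]
    have : Module.Free ℚ⟮ω ^ p⟯ ℚ⟮ω ^ p⟯⟮ω⟯ := Module.Free.of_divisionRing _ _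
    exact (Module.finrank_mul_finrank ℚ ℚ⟮ω ^ p⟯ ℚ⟮ω ^ p⟯⟮ω⟯).symm
  have h3 := Nat.totient_super_multiplicative p e
  have h4 : 0 < e.totient := Nat.totient_pos.2 he
  rw [hL, h2] at h1
  nlinarith

/-- A rational linear relation between powers of a primitive `d`-th root of unity with exponents
prime to a prime divisor `p` of `d` splits along the residue classes of the exponents mod `p`. -/
lemma IsPrimitiveRoot.sum_filter_mod_eq_zero {L : Type*} [Field L] [CharZero L]
    {ω : L} {d p : ℕ} (hd : 0 < d) (hpp : p.Prime) (hp : p ∣ d) (hω : IsPrimitiveRoot ω d)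
    {ι : Type*} [Fintype ι] (f : ι → ℕ) (c : ι → ℚ) (hf : ∀ i, ¬ p ∣ f i)
    (h : ∑ i, algebraMap ℚ L (c i) * ω ^ f i = 0) (r : ℕ) :
    ∑ i with f i % p = r, algebraMap ℚ L (c i) * ω ^ f i = 0 := by
  have hfpos : ∀ i, 0 < f i % p := fun i =>
    Nat.pos_of_ne_zero fun h0 => hf i (Nat.dvd_of_mod_eq_zero h0)
  rcases Nat.eq_zero_or_pos r with rfl | hr
  · exact Finset.sum_eq_zero fun i hi => absurd (Finset.mem_filter.1 hi).2 (hfpos i).ne'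
  have hω0 : ω ≠ 0 := hω.ne_zero hd.ne'
  set γ : ℚ⟮ω ^ p⟯ := AdjoinSimple.gen ℚ (ω ^ p)
  have hγ : algebraMap ℚ⟮ω ^ p⟯ L γ = ω ^ p := AdjoinSimple.algebraMap_gen ℚ (ω ^ p)
  let P : ℚ⟮ω ^ p⟯[X] :=
    ∑ i, C (algebraMap ℚ _ (c i) * γ ^ (f i / p)) * X ^ (f i % p - 1)
  have hterm : ∀ i, algebraMap ℚ⟮ω ^ p⟯ L (algebraMap ℚ _ (c i) * γ ^ (f i / p)) * ω ^ (f i % p) =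
      algebraMap ℚ L (c i) * ω ^ f i := fun i => by
    rw [map_mul, map_pow, hγ, ← IsScalarTower.algebraMap_apply, mul_assoc, ← pow_mul, ← pow_add,
      Nat.div_add_mod]
  have hroot : aeval ω P = 0 := by
    refine (mul_eq_zero.1 ?_ : aeval ω P = 0 ∨ ω = 0).resolve_right hω0
    rw [← h, map_sum, Finset.sum_mul]
    refine Finset.sum_congr rfl fun i _ => ?_
    rw [map_mul, aeval_C, map_pow, aeval_X, mul_assoc, ← pow_succ, Nat.sub_add_cancel (hfpos i),
      hterm]
  have hdeg : P.degree < (p - 1 : ℕ) := by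
    refine (degree_sum_le _ _).trans_lt ((Finset.sup_lt_iff (WithBot.bot_lt_coe _)).2 fun i _ => ?_)
    refine (degree_C_mul_X_pow_le _ _).trans_lt ?_
    have := Nat.mod_lt (f i) hpp.pos
    have := hfpos i
    exact_mod_cast (by omega : f i % p - 1 < p - 1)
  have hP : P = 0 := by
    by_contra hP
    have h1 := minpoly.degree_le_of_ne_zero _ ω hP hroot
    have h2 := hω.totient_le_natDegree_minpoly_adjoin_pow hd hp
    rw [Nat.totient_prime hpp] at h2
    have hint : IsIntegral ℚ⟮ω ^ p⟯ ω := (hω.isIntegral hd).tower_top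
    rw [degree_eq_natDegree (minpoly.ne_zero hint)] at h1
    exact absurd (h1.trans_lt hdeg) (not_lt.2 (by exact_mod_cast h2))
  have hcoeff := congrArg (fun Q => algebraMap ℚ⟮ω ^ p⟯ L (Q.coeff (r - 1)) * ω ^ r) hP
  simp only [P, finsetSum_coeff, coeff_C_mul_X_pow, coeff_zero, map_zero, zero_mul, map_sum,
    Finset.sum_mul] at hcoeff
  rw [Finset.sum_filter]
  refine Eq.trans (Finset.sum_congr rfl fun i _ => ?_) hcoeff
  have := hfpos i
  by_cases hi : f i % p = r
  · rw [if_pos hi, if_pos (by rw [hi]), ← hterm, hi]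
  · rw [if_neg hi, if_neg (by omega), map_zero, zero_mul]

/-- If `q ^ 2 = -1` modulo a prime `p` and `q` is even, then the first four powers of `q` are
distinct modulo `p`. -/
lemma pow_mod_injective_of_dvd_sq_add_one {p q : ℕ} (hp : p.Prime) (hq : Even q)
    (hpq : p ∣ q ^ 2 + 1) {i j : ℕ} (hi : i < 4) (hj : j < 4)
    (hij : (q : ZMod p) ^ i = (q : ZMod p) ^ j) : i = j := by
  have : Fact p.Prime := ⟨hp⟩
  have hsq : (q : ZMod p) ^ 2 = -1 := by
    have := (ZMod.natCast_eq_zero_iff _ _).2 hpq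
    push_cast at this
    exact eq_neg_of_add_eq_zero_left this
  have hp2 : p ≠ 2 := by
    rintro rfl
    obtain ⟨k, rfl⟩ := hq
    have : (k + k) ^ 2 + 1 = 2 * (2 * k ^ 2) + 1 := by ring
    omega
  have : Fact (2 < p) := ⟨lt_of_le_of_ne hp.two_le hp2.symm⟩
  have hord : orderOf (q : ZMod p) = 2 ^ (1 + 1) := by
    refine orderOf_eq_prime_pow ?_ ?_
    · rw [pow_one, hsq]
      exact ZMod.neg_one_ne_one
    · rw [pow_succ, pow_one, pow_mul, hsq, neg_one_sq]
  refine pow_injOn_Iio_orderOf ?_ ?_ hij <;> simp [hord] <;> omega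

/-- Two primitive `d`-th roots of unity with the same sum over the orbit of `x ↦ x ^ q` lie in the
same orbit, provided that `q` is even and `d` divides `q ^ 2 + 1`. -/
lemma IsPrimitiveRoot.exists_eq_pow_of_orbit_sum_eq {L : Type*} [Field L] [CharZero L]
    {ω g : L} {d q : ℕ} (hq : Even q) (hdq : d ∣ q ^ 2 + 1)
    (hω : IsPrimitiveRoot ω d) (hg : IsPrimitiveRoot g d)
    (h : ∑ i ∈ Finset.range 4, ω ^ q ^ i = ∑ i ∈ Finset.range 4, g ^ q ^ i) :
    ∃ i : ℕ, ω = g ^ q ^ i := by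
  have hd : 0 < d := Nat.pos_of_dvd_of_pos hdq (Nat.succ_pos _)
  by_cases hd1 : d = 1
  · subst hd1
    exact ⟨0, by rw [IsPrimitiveRoot.one_right_iff.1 hω, IsPrimitiveRoot.one_right_iff.1 hg]; simp⟩
  obtain ⟨p, hpp, hp⟩ := Nat.exists_prime_and_dvd hd1
  have : Fact p.Prime := ⟨hpp⟩
  have hpq : p ∣ q ^ 2 + 1 := hp.trans hdq
  have : NeZero d := ⟨hd.ne'⟩
  obtain ⟨a, -, ha, rfl⟩ := hω.isPrimitiveRoot_iff.1 hg
  have hpa : ¬ p ∣ a := fun hpa =>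
    hpp.one_lt.ne' (Nat.dvd_one.1 (ha ▸ Nat.dvd_gcd hpa hp))
  have hpq' : ∀ i, ¬ p ∣ q ^ i := fun i hi => by
    have h1 : p ∣ q ^ 2 := dvd_pow (hpp.dvd_of_dvd_pow hi) two_ne_zero
    exact hpp.one_lt.ne' (Nat.dvd_one.1 ((Nat.dvd_add_right h1).1 hpq))
  let f : Fin 4 ⊕ Fin 4 → ℕ := Sum.elim (fun i => q ^ (i : ℕ)) (fun i => a * q ^ (i : ℕ))
  let c : Fin 4 ⊕ Fin 4 → ℚ := Sum.elim (fun _ => 1) (fun _ => -1)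
  have hf : ∀ i, ¬ p ∣ f i := by
    rintro (i | i)
    · exact hpq' i
    · exact hpp.not_dvd_mul hpa (hpq' i)
  have hsum : ∑ i, algebraMap ℚ L (c i) * ω ^ f i = 0 := by
    rw [Finset.sum_range, Finset.sum_range] at h
    simp only [← pow_mul] at h
    simp [Fintype.sum_sum_type, f, c, h]
  have key := hω.sum_filter_mod_eq_zero hd hpp hp f c hf hsum (1 % p)
  rw [Finset.sum_filter, Fintype.sum_sum_type] at key
  have hmod : ∀ x : ℕ, x % p = 1 % p ↔ (x : ZMod p) = 1 := fun x => by
    rw [← Nat.cast_one (R := ZMod p), ZMod.natCast_eq_natCast_iff]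
    rfl
  have hleft : ∀ i : Fin 4, q ^ (i : ℕ) % p = 1 % p ↔ i = 0 := fun i => by
    rw [hmod, Nat.cast_pow]
    refine ⟨fun hi => ?_, fun hi => by simp [hi]⟩
    exact Fin.ext (pow_mod_injective_of_dvd_sq_add_one hpp hq hpq i.2 (by norm_num)
      (hi.trans (pow_zero _).symm))
  simp only [f, c, Sum.elim_inl, Sum.elim_inr, hleft, Finset.sum_ite_eq', Finset.mem_univ,
    if_true, map_one, map_neg, one_mul, Fin.val_zero, pow_zero, pow_one] at key
  by_cases hex : ∃ j : Fin 4, a * q ^ (j : ℕ) % p = 1 % p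
  · obtain ⟨j, hj⟩ := hex
    have hright : ∀ i : Fin 4, a * q ^ (i : ℕ) % p = 1 % p ↔ i = j := fun i => by
      refine ⟨fun hi => ?_, fun hi => hi ▸ hj⟩
      rw [hmod, Nat.cast_mul, Nat.cast_pow] at hi hj
      have ha0 : (a : ZMod p) ≠ 0 := fun h0 => hpa ((ZMod.natCast_eq_zero_iff _ _).1 h0)
      exact Fin.ext (pow_mod_injective_of_dvd_sq_add_one hpp hq hpq i.2 j.2
        (mul_left_cancel₀ ha0 (hi.trans hj.symm)))
    simp only [hright, Finset.sum_ite_eq', Finset.mem_univ, if_true] at key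
    refine ⟨j, ?_⟩
    rw [← pow_mul]
    linear_combination key
  · push Not at hex
    simp only [hex, if_false, Finset.sum_const_zero, add_zero] at key
    exact absurd key (hω.ne_zero hd.ne')

/-- The sum over the orbit of `x ↦ x ^ q` is constant on orbits of length dividing four. -/
lemma orbit_sum_pow {R : Type*} [CommSemiring R] {x : R} {q : ℕ} (hx : x ^ q ^ 4 = x) (j : ℕ) :
    ∑ i ∈ Finset.range 4, (x ^ q ^ j) ^ q ^ i = ∑ i ∈ Finset.range 4, x ^ q ^ i := by
  induction j with
  | zero => simp
  | succ j ih =>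
    rw [← ih]
    have hy : (x ^ q ^ j) ^ q ^ 4 = x ^ q ^ j := by rw [pow_right_comm, hx]
    rw [pow_succ, pow_mul]
    generalize x ^ q ^ j = y at hy
    simp only [← pow_mul, ← pow_succ']
    rw [Finset.sum_range_succ, Finset.sum_range_succ' (fun i => y ^ q ^ i), hy, pow_zero, pow_one]

/-- For a primitive `d`-th root of unity `ω` with `d ∣ q ^ 2 + 1` and `q` even, the orbit sum of
`ω` under `x ↦ x ^ q` generates a field containing the orbit sums of all powers of `ω`. -/
lemma IsPrimitiveRoot.orbit_sum_zpow_mem_adjoin {E : Type*} [Field E] [CharZero E]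
    {ω : E} {d q : ℕ} (hq : Even q) (hdq : d ∣ q ^ 2 + 1) (hω : IsPrimitiveRoot ω d) (b : ℤ) :
    ∑ i ∈ Finset.range 4, (ω ^ b) ^ q ^ i ∈ ℚ⟮∑ i ∈ Finset.range 4, ω ^ q ^ i⟯ := by
  have hd : 0 < d := Nat.pos_of_dvd_of_pos hdq (Nat.succ_pos _)
  have : NeZero d := ⟨hd.ne'⟩
  have : IsCyclotomicExtension {d} ℚ ℚ⟮ω⟯ := by
    change IsCyclotomicExtension {d} ℚ ℚ⟮ω⟯.toSubalgebra
    rw [adjoin_simple_toSubalgebra_of_isAlgebraic (hω.isIntegral hd).tower_top.isAlgebraic]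
    exact hω.adjoin_isCyclotomicExtension ℚ
  have : IsGalois ℚ ℚ⟮ω⟯ := IsCyclotomicExtension.isGalois {d} ℚ ℚ⟮ω⟯
  have : FiniteDimensional ℚ ℚ⟮ω⟯ := IsCyclotomicExtension.finiteDimensional {d} ℚ ℚ⟮ω⟯
  set w : ℚ⟮ω⟯ := AdjoinSimple.gen ℚ ω
  have hw : ℚ⟮ω⟯.val w = ω := AdjoinSimple.algebraMap_gen ℚ ω
  have hwp : IsPrimitiveRoot w d := by
    rw [← hw] at hω
    exact hω.of_map_of_injective (f := ℚ⟮ω⟯.val) ℚ⟮ω⟯.val.injective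
  have key : ∑ i ∈ Finset.range 4, (w ^ b) ^ q ^ i ∈ ℚ⟮∑ i ∈ Finset.range 4, w ^ q ^ i⟯ := by
    rw [← IsGalois.fixedField_fixingSubgroup ℚ⟮∑ i ∈ Finset.range 4, w ^ q ^ i⟯, mem_fixedField_iff]
    intro σ hσ
    have hfix := (mem_fixingSubgroup_iff _ σ).1 hσ _ (mem_adjoin_simple_self ℚ _)
    have hσw : IsPrimitiveRoot (σ w) d := hwp.map_of_injective σ.injective
    simp only [map_sum, map_pow, map_zpow₀] at hfix ⊢
    obtain ⟨j, hj⟩ := hwp.exists_eq_pow_of_orbit_sum_eq hq hdq hσw hfix.symm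
    have hper : (σ w) ^ q ^ 4 = σ w := by
      have h4 : σ w ^ (q ^ 2 + 1) = 1 := (hσw.pow_eq_one_iff_dvd _).2 hdq
      have h2 : σ w ^ q ^ 2 = (σ w)⁻¹ := eq_inv_of_mul_eq_one_left (by rw [← pow_succ, h4])
      rw [show q ^ 4 = q ^ 2 * q ^ 2 by ring, pow_mul, h2, inv_pow, h2, inv_inv]
    have hper' : (σ w ^ b) ^ q ^ 4 = σ w ^ b := by
      rw [← zpow_natCast, zpow_comm, zpow_natCast, hper]
    rw [← orbit_sum_pow hper' j]
    conv_rhs => rw [hj]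
    refine Finset.sum_congr rfl fun i _ => ?_
    congr 1
    rw [← zpow_natCast, zpow_comm, zpow_natCast]
  have hmap := (IntermediateField.mem_map (f := ℚ⟮ω⟯.val) _).2 ⟨_, key, rfl⟩
  have hadj := adjoin_map ℚ {∑ i ∈ Finset.range 4, w ^ q ^ i} ℚ⟮ω⟯.val
  rw [Set.image_singleton] at hadj
  replace hmap := hadj.le hmap
  simpa only [map_sum, map_pow, map_zpow₀, hw] using hmap

/-- Let `q = 2^{2n+1}` with `n ≥ 1`, `m` an integer, and `ζ` a primitive `N`-th root of
unity where `N = q ± 2^{n+1} + 1`. Then the field generated over `ℚ` by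
`S = {ζ^{mb} + ζ^{mqb} + ζ^{−mb} + ζ^{−mqb} : b ∈ ℤ}` equals
`ℚ(ζ^m + ζ^{mq} + ζ^{−m} + ζ^{−mq})`. -/
theorem field_gen_single_value_Suzuki (n : ℕ) (hn : 1 ≤ n) (q : ℕ)
    (hq : q = 2 ^ (2 * n + 1))
    (N : ℕ) (hN : N = q + 2 ^ (n + 1) + 1 ∨ N = q - 2 ^ (n + 1) + 1)
    (ζ : ℂ) (hζ : IsPrimitiveRoot ζ N) (m : ℤ)
    (S : Set ℂ)
    (hS : S = {x : ℂ | ∃ b : ℤ, x = ζ ^ (m * b) + ζ ^ (m * (q : ℤ) * b) +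
        ζ ^ (-(m * b)) + ζ ^ (-(m * (q : ℤ) * b))}) :
    Subfield.closure S =
      Subfield.closure {ζ ^ m + ζ ^ (m * (q : ℤ)) + ζ ^ (-m) + ζ ^ (-(m * (q : ℤ)))} := by
  have hqe : Even q := hq ▸ (even_two.pow_of_ne_zero (Nat.succ_ne_zero _))
  have hNq : N ∣ q ^ 2 + 1 := by
    have ht : q = 2 * (2 ^ n) ^ 2 := by rw [hq]; ring
    rw [pow_succ] at hN
    have hle : 1 ≤ 2 ^ n := Nat.one_le_two_pow
    generalize 2 ^ n = t at *
    subst ht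
    obtain ⟨s, rfl⟩ := Nat.exists_eq_add_of_le' hle
    have hsub : 2 * (s + 1) ^ 2 - (s + 1) * 2 = 2 * s ^ 2 + 2 * s := by
      rw [Nat.sub_eq_iff_eq_add (by nlinarith)]
      ring
    rcases hN with rfl | rfl
    · exact ⟨2 * s ^ 2 + 2 * s + 1, by ring⟩
    · rw [hsub]
      exact ⟨2 * (s + 1) ^ 2 + (s + 1) * 2 + 1, by ring⟩
  have hN0 : 0 < N := Nat.pos_of_dvd_of_pos hNq (Nat.succ_pos _)
  have hζ0 : ζ ≠ 0 := hζ.ne_zero hN0.ne'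
  have horder : orderOf (ζ ^ m) ∣ q ^ 2 + 1 := by
    refine (orderOf_dvd_of_pow_eq_one ?_).trans hNq
    rw [← zpow_natCast, zpow_comm, zpow_natCast, hζ.pow_eq_one, one_zpow]
  have hinv : ζ ^ ((q : ℤ) ^ 2) = ζ⁻¹ := by
    refine eq_inv_of_mul_eq_one_left ?_
    rw [← zpow_add_one₀ hζ0]
    exact_mod_cast (hζ.pow_eq_one_iff_dvd _).2 hNq
  have hsum : ∀ b : ℤ, ζ ^ (m * b) + ζ ^ (m * (q : ℤ) * b) + ζ ^ (-(m * b)) +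
      ζ ^ (-(m * (q : ℤ) * b)) = ∑ i ∈ Finset.range 4, ((ζ ^ m) ^ b) ^ q ^ i := fun b => by
    have h2 : ζ ^ (-(m * b)) = ζ ^ (m * b * (q : ℤ) ^ 2) := by
      rw [mul_comm _ ((q : ℤ) ^ 2), zpow_mul, hinv, inv_zpow, zpow_neg]
    have h3 : ζ ^ (-(m * (q : ℤ) * b)) = ζ ^ (m * b * (q : ℤ) ^ 3) := by
      rw [show m * b * (q : ℤ) ^ 3 = (q : ℤ) ^ 2 * (m * q * b) by ring, zpow_mul, hinv, inv_zpow,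
        zpow_neg]
    rw [h2, h3, mul_right_comm m (q : ℤ) b]
    simp only [← zpow_natCast, ← zpow_mul, Finset.sum_range_succ, Finset.sum_range_zero]
    simp
  have hone := hsum 1
  simp only [mul_one, zpow_one] at hone
  rw [hone]
  refine le_antisymm (Subfield.closure_le.2 ?_) (Subfield.closure_mono ?_)
  · rw [hS]
    rintro x ⟨b, rfl⟩
    rw [hsum]
    have hmem := (IsPrimitiveRoot.orderOf (ζ ^ m)).orbit_sum_zpow_mem_adjoin hqe horder b
    set K := Subfield.closure {∑ i ∈ Finset.range 4, (ζ ^ m) ^ q ^ i}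
    have hle : ℚ⟮∑ i ∈ Finset.range 4, (ζ ^ m) ^ q ^ i⟯ ≤
        K.toIntermediateField (fun r => by simp) :=
      adjoin_simple_le_iff.2 (Subfield.subset_closure rfl)
    exact hle hmem
  · rw [hS, Set.singleton_subset_iff]
    exact ⟨1, by rw [hsum, zpow_one]⟩
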